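/- Let F : ℝ^m → ℝ^m be L-Lipschitz and r : ℝ^m → ℝ ∪ {+∞} proper, convex and lower semicontinuous. Consider one deterministic FBF step: w_k = prox_{α_k r}(z_k − α_k F(z_k)), z_{k+1} = w_k + α_k (F(z_k) − F(w_k)). Then for every z ∈ ℝ^m: α_k g(w_k,z) + ½ ‖z_{k+1} − z‖² ≤ ½ ‖z_k − z‖² − ½ (1 − α_k² L²) ‖z_k − w_k‖², where g(w,z) := ⟨F(w), w−z⟩ + r(w) − r(z). -/

import Mathlib

open scoped RealInnerProductSpace ENNReal
open MeasureTheory ProbabilityTheory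

noncomputable section

/-- A monotone operator on a real inner product space. -/
def MonotoneOp {E : Type*} [NormedAddCommGroup E] [InnerProductSpace ℝ E]
    (F : E → E) : Prop :=
  ∀ z z' : E, 0 ≤ ⟪F z - F z', z - z'⟫

/-- An `L`-Lipschitz operator. -/
def LipschitzOp {E : Type*} [NormedAddCommGroup E] (L : ℝ) (F : E → E) : Prop :=
  ∀ z z' : E, ‖F z - F z'‖ ≤ L * ‖z - z'‖

/-- A proper function with values in `ℝ ∪ {+∞}`: it never takes the value `-∞`
and is finite somewhere. -/
def ProperFn {E : Type*} (r : E → EReal) : Prop :=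
  (∀ w, r w ≠ ⊥) ∧ (∃ w, r w ≠ ⊤)

/-- Convexity of an extended-real-valued function. -/
def ConvexFn {E : Type*} [AddCommMonoid E] [Module ℝ E] (r : E → EReal) : Prop :=
  ∀ x y : E, ∀ a b : ℝ, 0 ≤ a → 0 ≤ b → a + b = 1 →
    r (a • x + b • y) ≤ (a : EReal) * r x + (b : EReal) * r y

/-- `p` is the proximal point `prox_{lam·r}(x)`, i.e. a minimizer of
`w' ↦ r(w') + (1/(2·lam))‖w' - x‖²`. -/
def IsProxPt {E : Type*} [NormedAddCommGroup E] (r : E → EReal) (lam : ℝ)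
    (x p : E) : Prop :=
  ∀ q : E, r p + (((2 * lam)⁻¹ * ‖p - x‖ ^ 2 : ℝ) : EReal)
    ≤ r q + (((2 * lam)⁻¹ * ‖q - x‖ ^ 2 : ℝ) : EReal)

/-- One term `⟨F(z), w - z⟩ + r(w) - r(z)` of the restricted gap function,
with the convention that `∞ - ∞` is interpreted as `+∞`. -/
def gapTerm {E : Type*} [NormedAddCommGroup E] [InnerProductSpace ℝ E]
    (F : E → E) (r : E → EReal) (w z : E) : EReal :=
  if r w = ⊤ ∧ r z = ⊤ then ⊤
  else ((⟪F z, w - z⟫ : ℝ) : EReal) + r w - r z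

/-- The restricted gap function `G_B(w) = sup_{z ∈ B} ⟨F(z), w - z⟩ + r(w) - r(z)`. -/
def gapFn {E : Type*} [NormedAddCommGroup E] [InnerProductSpace ℝ E]
    (F : E → E) (r : E → EReal) (B : Set E) (w : E) : EReal :=
  ⨆ z ∈ B, gapTerm F r w z

/-- The quantity `g(w,z) = ⟨F(w), w - z⟩ + r(w) - r(z)` associated to the strong
variational inequality. -/
def gFn {E : Type*} [NormedAddCommGroup E] [InnerProductSpace ℝ E]
    (F : E → E) (r : E → EReal) (w z : E) : EReal :=
  ((⟪F w, w - z⟫ : ℝ) : EReal) + r w - r z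

/-- `w` solves the monotone inclusion `0 ∈ F(w) + ∂r(w)`, i.e. `-F(w) ∈ ∂r(w)`. -/
def SolvesInclusion {E : Type*} [NormedAddCommGroup E] [InnerProductSpace ℝ E]
    (F : E → E) (r : E → EReal) (w : E) : Prop :=
  ∀ w' : E, ((⟪-F w, w' - w⟫ : ℝ) : EReal) + r w ≤ r w'

/-- The positive part of an extended real number, as an element of `ℝ≥0∞`. -/
def erealPosPart (x : EReal) : ℝ≥0∞ :=
  if x = ⊤ then ⊤ else ENNReal.ofReal x.toReal

/-- The expectation of an extended-real-valued random variable: the difference of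
the (unsigned) integrals of its positive and negative parts. -/
def erealExp {Ω : Type*} [MeasurableSpace Ω] (μ : Measure Ω) (X : Ω → EReal) : EReal :=
  ((∫⁻ ω, erealPosPart (X ω) ∂μ : ℝ≥0∞) : EReal)
    - ((∫⁻ ω, erealPosPart (-(X ω)) ∂μ : ℝ≥0∞) : EReal)

/-- The weighted average `w̄_K = (∑_{k<K} α_k w_k) / (∑_{k<K} α_k)`. -/
def avgIter {E : Type*} [AddCommGroup E] [Module ℝ E] (α : ℕ → ℝ) (w : ℕ → E)
    (K : ℕ) : E :=
  (∑ k ∈ Finset.range K, α k)⁻¹ • ∑ k ∈ Finset.range K, α k • w k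

end

/-- A proximal point of a proper function lies in its effective domain. -/
lemma IsProxPt.ne_top {E : Type*} [NormedAddCommGroup E] {r : E → EReal} {lam : ℝ} {x p : E}
    (hproper : ProperFn r) (hp : IsProxPt r lam x p) : r p ≠ ⊤ := by
  obtain ⟨q, hq⟩ := hproper.2
  intro htop
  have h := hp q
  rw [htop, EReal.top_add_coe, top_le_iff] at h
  exact EReal.add_ne_top hq (EReal.coe_ne_top _) h

/-- The variational inequality characterizing proximal points of a convex function. -/
lemma IsProxPt.mul_sub_le_inner {E : Type*} [NormedAddCommGroup E] [InnerProductSpace ℝ E]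
    {r : E → EReal} {lam : ℝ} {x p z : E} (hconv : ConvexFn r) (hlam : 0 < lam)
    (hp : IsProxPt r lam x p) {a b : ℝ} (ha : r p = a) (hb : r z = b) :
    lam * (a - b) ≤ ⟪p - x, z - p⟫ := by
  have key : ∀ t : ℝ, 0 < t → t ≤ 1 →
      lam * (a - b) ≤ ⟪p - x, z - p⟫ + t * (‖z - p‖ ^ 2 / 2) := by
    intro t ht ht1
    have h := (hp ((1 - t) • p + t • z)).trans
      (add_le_add_left (hconv p z (1 - t) t (by linarith) ht.le (by ring)) _)
    rw [ha, hb, show (1 - t) • p + t • z - x = (p - x) + t • (z - p) by module] at h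
    norm_cast at h
    rw [norm_add_sq_real, norm_smul, inner_smul_right, mul_pow, Real.norm_eq_abs, sq_abs] at h
    have h' : t * (lam * (a - b)) ≤ t * (⟪p - x, z - p⟫ + t * (‖z - p‖ ^ 2 / 2)) := by
      have h2 := mul_le_mul_of_nonneg_left h hlam.le
      field_simp at h2
      linarith
    exact le_of_mul_le_mul_left h' ht
  have hlim : Filter.Tendsto (fun t : ℝ => ⟪p - x, z - p⟫ + t * (‖z - p‖ ^ 2 / 2))
      (nhdsWithin 0 (Set.Ioi 0)) (nhds ⟪p - x, z - p⟫) := by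
    have hc : Continuous fun t : ℝ => ⟪p - x, z - p⟫ + t * (‖z - p‖ ^ 2 / 2) := by fun_prop
    simpa using (hc.tendsto 0).mono_left nhdsWithin_le_nhds
  refine ge_of_tendsto hlim ?_
  filter_upwards [Ioc_mem_nhdsGT one_pos] with t ht using key t ht.1 ht.2

/-- The real-valued one-step estimate, where `u = F zk`, `v = F w` and `s = r w - r z`. -/
lemma forward_backward_forward_estimate {E : Type*} [NormedAddCommGroup E]
    [InnerProductSpace ℝ E] {α L s : ℝ} {x w z u v : E} (hlip : ‖u - v‖ ≤ L * ‖x - w‖)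
    (hprox : α * s ≤ ⟪w - (x - α • u), z - w⟫) :
    α * (⟪v, w - z⟫ + s) + 2⁻¹ * ‖w + α • (u - v) - z‖ ^ 2
      ≤ 2⁻¹ * ‖x - z‖ ^ 2 - 2⁻¹ * (1 - α ^ 2 * L ^ 2) * ‖x - w‖ ^ 2 := by
  have hsq : α ^ 2 * ‖u - v‖ ^ 2 ≤ α ^ 2 * (L * ‖x - w‖) ^ 2 := by gcongr
  have h₁ : ‖w + α • (u - v) - z‖ ^ 2 = ‖w - z‖ ^ 2
      + 2 * α * (⟪u, w - z⟫ - ⟪v, w - z⟫) + α ^ 2 * ‖u - v‖ ^ 2 := by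
    rw [show w + α • (u - v) - z = (w - z) + α • (u - v) by abel, norm_add_sq_real,
      inner_smul_right, norm_smul, mul_pow, Real.norm_eq_abs, sq_abs,
      real_inner_comm, inner_sub_left]
    ring
  have h₂ : ‖x - z‖ ^ 2 = ‖x - w‖ ^ 2 + 2 * ⟪x - w, w - z⟫ + ‖w - z‖ ^ 2 := by
    rw [← norm_add_sq_real, sub_add_sub_cancel]
  have h₃ : ⟪w - (x - α • u), z - w⟫ = ⟪x - w, w - z⟫ - α * ⟪u, w - z⟫ := by
    rw [show w - (x - α • u) = -((x - w) - α • u) by abel, ← neg_sub w z, inner_neg_neg,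
      inner_sub_left, real_inner_smul_left]
  rw [h₁, h₂]
  rw [h₃] at hprox
  linarith

/-- deterministic FBF one-step estimate.
One FBF step `w_k = prox_{α_k r}(z_k - α_k F(z_k))`,
`z_{k+1} = w_k + α_k (F(z_k) - F(w_k))` satisfies, for every `z`:
`α_k g(w_k,z) + ½‖z_{k+1}-z‖² ≤ ½‖z_k-z‖² - ½(1-α_k²L²)‖z_k-w_k‖²`. -/
theorem fbf_one_step {m : ℕ}
    (F : EuclideanSpace ℝ (Fin m) → EuclideanSpace ℝ (Fin m)) (L : ℝ) (hL : 0 < L)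
    (hlip : LipschitzOp L F)
    (r : EuclideanSpace ℝ (Fin m) → EReal)
    (hproper : ProperFn r) (hconv : ConvexFn r) (hlsc : LowerSemicontinuous r)
    (αk : ℝ) (hαk : 0 < αk)
    (zk wk zk1 : EuclideanSpace ℝ (Fin m))
    (hw : IsProxPt r αk (zk - αk • F zk) wk)
    (hz : zk1 = wk + αk • (F zk - F wk))
    (z : EuclideanSpace ℝ (Fin m)) :
    (αk : EReal) * gFn F r wk z + (((2 : ℝ)⁻¹ * ‖zk1 - z‖ ^ 2 : ℝ) : EReal)
      ≤ (((2 : ℝ)⁻¹ * ‖zk - z‖ ^ 2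
          - (2 : ℝ)⁻¹ * (1 - αk ^ 2 * L ^ 2) * ‖zk - wk‖ ^ 2 : ℝ) : EReal) := by
  have hwt := hw.ne_top hproper
  obtain ⟨a, ha⟩ : ∃ a : ℝ, r wk = a := ⟨_, (EReal.coe_toReal hwt (hproper.1 wk)).symm⟩
  by_cases hzt : r z = ⊤
  · simp [gFn, ha, hzt, ← EReal.coe_add, EReal.coe_mul_bot_of_pos hαk]
  obtain ⟨b, hb⟩ : ∃ b : ℝ, r z = b := ⟨_, (EReal.coe_toReal hzt (hproper.1 z)).symm⟩
  have h := forward_backward_forward_estimate (hlip zk wk)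
    (hw.mul_sub_le_inner hconv hαk ha hb)
  rw [gFn, ha, hb, hz]
  norm_cast
  rwa [add_sub_assoc]
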